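/- Let G be a proper Helly circular-arc graph that is not chordal. Then in every arc model A for G, every set S of vertices whose arcs together cover the whole circle satisfies |S| ≥ 4. -/

import Mathlib

/-- A unit interval graph: vertices can be mapped to reals so that two distinct
vertices are adjacent iff their images are within distance 1. -/
def SimpleGraph.IsUnitIntervalGraph {V : Type*} (G : SimpleGraph V) : Prop :=
  ∃ f : V → ℝ, ∀ u v : V, u ≠ v → (G.Adj u v ↔ |f u - f v| ≤ 1)

/-- `f : ZMod n → V` describes a hole (induced cycle of length `n ≥ 4`) of `G`. -/
def SimpleGraph.IsHoleOn {V : Type*} (G : SimpleGraph V) (n : ℕ) (f : ZMod n → V) : Prop :=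
  4 ≤ n ∧ Function.Injective f ∧
    ∀ i j : ZMod n, (G.Adj (f i) (f j) ↔ (i = j + 1 ∨ j = i + 1))

def SimpleGraph.HasHole {V : Type*} (G : SimpleGraph V) : Prop :=
  ∃ (n : ℕ) (f : ZMod n → V), G.IsHoleOn n f

/-- A graph is chordal if it has no hole. -/
def SimpleGraph.Chordal {V : Type*} (G : SimpleGraph V) : Prop := ¬ G.HasHole

/-- `G` contains an induced copy of `H`. -/
def SimpleGraph.HasInducedCopy {V W : Type*} (G : SimpleGraph V) (H : SimpleGraph W) : Prop :=
  ∃ f : W → V, Function.Injective f ∧ ∀ a b : W, G.Adj (f a) (f b) ↔ H.Adj a b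

/-- The claw `K_{1,3}`, centered at vertex `0`. -/
def clawGraph : SimpleGraph (Fin 4) := SimpleGraph.fromRel (fun a _ => a = 0)

/-- The tent `S_3`: triangle on `0,1,2`; vertex `i+3` adjacent to `{0,1,2} \ {i}`. -/
def tentGraph : SimpleGraph (Fin 6) := SimpleGraph.fromRel (fun a b =>
  (a.val < 3 ∧ b.val < 3) ∨ (a.val < 3 ∧ 3 ≤ b.val ∧ b.val ≠ a.val + 3))

/-- The net: triangle on `0,1,2`; pendant vertex `i+3` adjacent exactly to `i`. -/
def netGraph : SimpleGraph (Fin 6) := SimpleGraph.fromRel (fun a b =>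
  (a.val < 3 ∧ b.val < 3) ∨ (a.val < 3 ∧ b.val = a.val + 3))

/-- The cycle `C_n` on `ZMod n`. -/
def cycleG (n : ℕ) : SimpleGraph (ZMod n) := SimpleGraph.fromRel (fun a b => a = b + 1)

/-- The wheel `W_n`: a cycle `C_n` plus a hub (`none`) adjacent to all cycle vertices. -/
def wheelG (n : ℕ) : SimpleGraph (Option (ZMod n)) := SimpleGraph.fromRel (fun a b =>
  a = none ∨ ∃ i j : ZMod n, a = some i ∧ b = some j ∧ i = j + 1)

/-- `C*_n`: a cycle `C_n` plus an isolated vertex (`none`). -/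
def cycleStarG (n : ℕ) : SimpleGraph (Option (ZMod n)) := SimpleGraph.fromRel (fun a b =>
  ∃ i j : ZMod n, a = some i ∧ b = some j ∧ i = j + 1)

/-- Raw data of a family of closed arcs on the circle `ℝ/Lℤ`: each vertex `v` gets the
arc traversed clockwise from (the image of) `src v` to `src v + len v`. -/
structure PreArcModel (V : Type*) where
  L : ℝ
  L_pos : 0 < L
  src : V → ℝ
  len : V → ℝ
  len_pos : ∀ v, 0 < len v
  len_lt : ∀ v, len v < L

namespace PreArcModel

variable {V : Type*}

/-- The counterclockwise endpoint of the arc of `v`. -/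
noncomputable def ccp (A : PreArcModel V) (v : V) : AddCircle A.L := (A.src v : ℝ)

/-- The clockwise endpoint of the arc of `v`. -/
noncomputable def cp (A : PreArcModel V) (v : V) : AddCircle A.L :=
  ((A.src v + A.len v : ℝ) : AddCircle A.L)

/-- The closed arc assigned to `v`, as a subset of the circle. -/
noncomputable def arc (A : PreArcModel V) (v : V) : Set (AddCircle A.L) :=
  (fun x : ℝ => (x : AddCircle A.L)) '' Set.Icc (A.src v) (A.src v + A.len v)

/-- All endpoints of all arcs are pairwise distinct. -/
def EndpointsDistinct (A : PreArcModel V) : Prop :=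
  Function.Injective (fun p : V × Bool => if p.2 then A.cp p.1 else A.ccp p.1)

/-- `A` is an arc model of the graph `G`: endpoints are pairwise distinct and two
distinct vertices are adjacent iff their arcs intersect. -/
def IsModelOf (A : PreArcModel V) (G : SimpleGraph V) : Prop :=
  A.EndpointsDistinct ∧ ∀ u v : V, u ≠ v → (G.Adj u v ↔ (A.arc u ∩ A.arc v).Nonempty)

/-- No arc is properly contained in another arc. -/
def Proper (A : PreArcModel V) : Prop := ∀ u v : V, ¬ A.arc u ⊂ A.arc v

/-- Every set of pairwise intersecting arcs has a common point. -/
def Helly (A : PreArcModel V) : Prop :=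
  ∀ S : Set V, (∀ u ∈ S, ∀ v ∈ S, (A.arc u ∩ A.arc v).Nonempty) →
    (⋂ v ∈ S, A.arc v).Nonempty

/-- The set `K_A(α)` of vertices whose arc contains the point `α`. -/
noncomputable def K (A : PreArcModel V) (α : AddCircle A.L) : Set V := {v | α ∈ A.arc v}

/-- The edge set `E→_A(α)`: edges `vu` of `G` with `v ∈ K_A(α)`, `u ∉ K_A(α)`,
and `A(v)` intersecting `A(u)` from the left (`cp v ∈ A(u)`). -/
noncomputable def Eout (A : PreArcModel V) (G : SimpleGraph V) (α : AddCircle A.L) :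
    Set (Sym2 V) :=
  {e | ∃ v u : V, e = s(v, u) ∧ G.Adj v u ∧ α ∈ A.arc v ∧ α ∉ A.arc u ∧ A.cp v ∈ A.arc u}

/-- The edge set `E→_{A - Vm}(α)` of the model obtained by removing the arcs of `Vm`. -/
noncomputable def EoutAvoid (A : PreArcModel V) (G : SimpleGraph V) (Vm : Set V)
    (α : AddCircle A.L) : Set (Sym2 V) :=
  {e | ∃ v u : V, e = s(v, u) ∧ G.Adj v u ∧ v ∉ Vm ∧ u ∉ Vm ∧
    α ∈ A.arc v ∧ α ∉ A.arc u ∧ A.cp v ∈ A.arc u}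

end PreArcModel

/-- A proper Helly circular-arc graph: a graph admitting an arc model that is both
proper and Helly. -/
def SimpleGraph.IsPHCA {V : Type*} (G : SimpleGraph V) : Prop :=
  ∃ A : PreArcModel V, A.IsModelOf G ∧ A.Proper ∧ A.Helly

/-- Adjacency pattern of a fat `W_5` among the six clique-classes: classes `0..4`
form the fat hole (consecutive classes modulo 5 are completely adjacent), class `5`
is the hub (completely adjacent to everything), and each class is a clique. -/
def fatW5Rel (p q : Fin 6) : Prop :=
  p = q ∨ p = 5 ∨ q = 5 ∨ (p.val + 1) % 5 = q.val ∨ (q.val + 1) % 5 = p.val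

/-- A fat `W_5`: vertex set partitioned into six nonempty cliques with the `W_5`
adjacency pattern between the classes. -/
def SimpleGraph.IsFatW5 {V : Type*} (G : SimpleGraph V) : Prop :=
  ∃ part : V → Fin 6, Function.Surjective part ∧
    ∀ u v : V, u ≠ v → (G.Adj u v ↔ fatW5Rel (part u) (part v))

/-- `Gb` is a maximum spanning unit interval subgraph of `G`. -/
def IsMaxSpanningUIG {V : Type*} (G Gb : SimpleGraph V) : Prop :=
  Gb ≤ G ∧ Gb.IsUnitIntervalGraph ∧
    ∀ H : SimpleGraph V, H ≤ G → H.IsUnitIntervalGraph →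
      H.edgeSet.ncard ≤ Gb.edgeSet.ncard

/-- `(Vm, Em, Ep)` is an editing set of `G`: `Em` is a set of edges of `G - Vm`,
`Ep` a set of non-edges of `G - Vm`, and deleting `Em` and adding `Ep` makes
`G - Vm` a unit interval graph. -/
def IsEditingSet {V : Type*} (G : SimpleGraph V) (Vm : Set V) (Em Ep : Set (Sym2 V)) : Prop :=
  Em ⊆ G.edgeSet ∧ (∀ e ∈ Em, ∀ x ∈ e, x ∉ Vm) ∧
  (∀ e ∈ Ep, ¬ e.IsDiag ∧ e ∉ G.edgeSet ∧ ∀ x ∈ e, x ∉ Vm) ∧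
  ((SimpleGraph.fromEdgeSet ((G.edgeSet \ Em) ∪ Ep)).induce {v | v ∉ Vm}).IsUnitIntervalGraph


namespace PreArcModel

variable {V : Type*}

/-- The representative in `[c, c + L)` of a point of the circle. -/
noncomputable def pos (A : PreArcModel V) (c : ℝ) (x : AddCircle A.L) : ℝ :=
  haveI : Fact (0 < A.L) := ⟨A.L_pos⟩
  (AddCircle.equivIco A.L c x : ℝ)

lemma le_pos (A : PreArcModel V) (c : ℝ) (x : AddCircle A.L) : c ≤ A.pos c x :=
  have : Fact (0 < A.L) := ⟨A.L_pos⟩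
  (AddCircle.equivIco A.L c x).2.1

lemma pos_lt (A : PreArcModel V) (c : ℝ) (x : AddCircle A.L) : A.pos c x < c + A.L :=
  have : Fact (0 < A.L) := ⟨A.L_pos⟩
  (AddCircle.equivIco A.L c x).2.2

lemma coe_pos (A : PreArcModel V) (c : ℝ) (x : AddCircle A.L) :
    ((A.pos c x : ℝ) : AddCircle A.L) = x :=
  have : Fact (0 < A.L) := ⟨A.L_pos⟩
  (AddCircle.equivIco A.L c).symm_apply_apply x

lemma pos_coe_self (A : PreArcModel V) (c : ℝ) : A.pos c (c : AddCircle A.L) = c := by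
  have : Fact (0 < A.L) := ⟨A.L_pos⟩
  exact AddCircle.equivIco_coe_of_mem ⟨le_rfl, by linarith [A.L_pos]⟩

lemma mem_arc_iff (A : PreArcModel V) (c : ℝ) (v : V) (x : AddCircle A.L) :
    x ∈ A.arc v ↔ ∃ k : ℤ, A.src v ≤ A.pos c x + k * A.L ∧
      A.pos c x + k * A.L ≤ A.src v + A.len v := by
  constructor
  · rintro ⟨y, hy, rfl⟩
    have h := A.coe_pos c (y : AddCircle A.L)
    rw [← sub_eq_zero, ← AddCircle.coe_sub, AddCircle.coe_eq_zero_iff] at h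
    obtain ⟨k, hk⟩ := h
    rw [zsmul_eq_mul] at hk
    have h' : A.pos c (y : AddCircle A.L) + (-k : ℤ) * A.L = y := by push_cast; linarith
    refine ⟨-k, ?_⟩
    simp only [h']
    exact hy
  · rintro ⟨k, h1, h2⟩
    refine ⟨_, ⟨h1, h2⟩, ?_⟩
    have h := (AddCircle.coe_eq_zero_iff A.L (x := (k : ℝ) * A.L)).2 ⟨k, by simp⟩
    simp only [AddCircle.coe_add, h, add_zero, A.coe_pos]

lemma mem_arc_iff_pos_src (A : PreArcModel V) (v : V) (x : AddCircle A.L) :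
    x ∈ A.arc v ↔ A.pos (A.src v) x ≤ A.src v + A.len v := by
  have h1 := A.le_pos (A.src v) x
  have h2 := A.pos_lt (A.src v) x
  have h3 := A.len_lt v
  have hL := A.L_pos
  rw [A.mem_arc_iff (A.src v)]
  constructor
  · rintro ⟨k, hk1, hk2⟩
    rcases lt_trichotomy k 0 with hk | rfl | hk
    · have : (k : ℝ) ≤ -1 := by exact_mod_cast (by omega : k ≤ -1)
      nlinarith
    · simpa using hk2
    · have : (1 : ℝ) ≤ k := by exact_mod_cast hk
      nlinarith
  · intro h
    exact ⟨0, by simpa using h1, by simpa using h⟩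

/-- Seen from a base point, an arc is an interval or the complement of one. -/
lemma exists_arc_form (A : PreArcModel V) (c : ℝ) (v : V) : ∃ s t : ℝ,
    (∀ x, x ∈ A.arc v ↔ s ≤ A.pos c x ∧ A.pos c x ≤ t) ∨
    (∀ x, x ∈ A.arc v ↔ A.pos c x ≤ t ∨ s ≤ A.pos c x) := by
  have hL := A.L_pos
  have hl := A.len_pos v
  have hl' := A.len_lt v
  obtain ⟨m, ⟨hm1, hm2⟩, -⟩ := existsUnique_sub_zsmul_mem_Ico hL (A.src v) c
  rw [zsmul_eq_mul] at hm1 hm2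
  set a := A.src v - m * A.L with ha
  have key : ∀ x, x ∈ A.arc v ↔ ∃ k : ℤ, a ≤ A.pos c x + k * A.L ∧
      A.pos c x + k * A.L ≤ a + A.len v := by
    intro x
    rw [A.mem_arc_iff c]
    constructor
    · rintro ⟨k, h1, h2⟩
      exact ⟨k - m, by push_cast; linarith, by push_cast; linarith⟩
    · rintro ⟨k, h1, h2⟩
      exact ⟨k + m, by push_cast; linarith, by push_cast; linarith⟩
  by_cases hc : a + A.len v < c + A.L
  · refine ⟨a, a + A.len v, Or.inl fun x => ?_⟩
    have h1 := A.le_pos c x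
    have h2 := A.pos_lt c x
    rw [key]
    constructor
    · rintro ⟨k, hk1, hk2⟩
      rcases lt_trichotomy k 0 with hk | rfl | hk
      · have : (k : ℝ) ≤ -1 := by exact_mod_cast (by omega : k ≤ -1)
        nlinarith
      · simpa using And.intro hk1 hk2
      · have : (1 : ℝ) ≤ k := by exact_mod_cast hk
        nlinarith
    · intro h
      exact ⟨0, by simpa using h.1, by simpa using h.2⟩
  · refine ⟨a, a + A.len v - A.L, Or.inr fun x => ?_⟩
    have h1 := A.le_pos c x
    have h2 := A.pos_lt c x
    rw [key]
    constructor
    · rintro ⟨k, hk1, hk2⟩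
      rcases lt_trichotomy k 0 with hk | rfl | hk
      · have : (k : ℝ) ≤ -1 := by exact_mod_cast (by omega : k ≤ -1)
        nlinarith
      · right; simpa using hk1
      · have : (1 : ℝ) ≤ k := by exact_mod_cast hk
        left; nlinarith
    · rintro (h | h)
      · exact ⟨1, by push_cast; linarith, by push_cast; linarith⟩
      · exact ⟨0, by push_cast; linarith, by push_cast; linarith⟩

/-- Seen from a point outside it, an arc is an interval. -/
lemma exists_arc_interval (A : PreArcModel V) {c : ℝ} {v : V}
    (hc : (c : AddCircle A.L) ∉ A.arc v) :
    ∃ s t : ℝ, ∀ x, x ∈ A.arc v ↔ s ≤ A.pos c x ∧ A.pos c x ≤ t := by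
  obtain ⟨s, t, h | h⟩ := A.exists_arc_form c v
  · exact ⟨s, t, h⟩
  · rw [h, A.pos_coe_self, not_or, not_le] at hc
    refine ⟨s, c + A.L, fun x => ?_⟩
    have h1 := A.le_pos c x
    have h2 := A.pos_lt c x
    rw [h]
    exact ⟨fun h => h.elim (fun h => by linarith) fun h => ⟨h, h2.le⟩, fun h => Or.inr h.1⟩

lemma arc_nonempty (A : PreArcModel V) (v : V) : (A.arc v).Nonempty :=
  ⟨_, A.src v, ⟨le_rfl, by linarith [A.len_pos v]⟩, rfl⟩

lemma isClosed_arc (A : PreArcModel V) (v : V) : IsClosed (A.arc v) := by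
  have : Fact (0 < A.L) := ⟨A.L_pos⟩
  exact (isCompact_Icc.image (AddCircle.continuous_mk' A.L)).isClosed

lemma isPreconnected_compl_arc (A : PreArcModel V) (v : V) : IsPreconnected (A.arc v)ᶜ := by
  have h : (A.arc v)ᶜ = (fun x : ℝ => (x : AddCircle A.L)) ''
      Set.Ioo (A.src v + A.len v) (A.src v + A.L) := by
    have : Fact (0 < A.L) := ⟨A.L_pos⟩
    ext x
    rw [Set.mem_compl_iff, A.mem_arc_iff_pos_src, not_le]
    constructor
    · intro hx
      exact ⟨_, ⟨hx, A.pos_lt _ x⟩, A.coe_pos _ x⟩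
    · rintro ⟨y, ⟨h1, h2⟩, rfl⟩
      have : A.pos (A.src v) (y : AddCircle A.L) = y :=
        AddCircle.equivIco_coe_of_mem ⟨by linarith [A.len_pos v], h2⟩
      simpa only [this] using h1
  rw [h]
  exact isPreconnected_Ioo.image _ (AddCircle.continuous_mk' A.L).continuousOn

/-- Two arcs covering the circle intersect. -/
lemma inter_nonempty_of_union (A : PreArcModel V) {u v : V}
    (h : A.arc u ∪ A.arc v = Set.univ) : (A.arc u ∩ A.arc v).Nonempty := by
  by_contra hne
  rw [Set.not_nonempty_iff_eq_empty] at hne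
  rcases isPreconnected_iff_subset_of_disjoint_closed.1 isPreconnected_univ _ _
    (A.isClosed_arc u) (A.isClosed_arc v) h.ge (by simp [hne]) with h' | h'
  · obtain ⟨x, hx⟩ := A.arc_nonempty v
    exact hne.le ⟨h' trivial, hx⟩
  · obtain ⟨x, hx⟩ := A.arc_nonempty u
    exact hne.le ⟨hx, h' trivial⟩

/-- If two of three arcs covering the circle are disjoint, one of them is redundant. -/
lemma union_of_disjoint (A : PreArcModel V) {u v w : V}
    (h : ∀ x, x ∈ A.arc u ∨ x ∈ A.arc v ∨ x ∈ A.arc w) (hd : ¬ (A.arc u ∩ A.arc v).Nonempty) :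
    ∃ y, A.arc y ∪ A.arc w = Set.univ := by
  rw [Set.not_nonempty_iff_eq_empty] at hd
  have key : ∀ y, (A.arc w)ᶜ ⊆ A.arc y → A.arc y ∪ A.arc w = Set.univ := fun y hy =>
    Set.eq_univ_of_forall fun x => (em (x ∈ A.arc w)).elim Or.inr fun hx => Or.inl (hy hx)
  rcases isPreconnected_iff_subset_of_disjoint_closed.1 (A.isPreconnected_compl_arc w) _ _
    (A.isClosed_arc u) (A.isClosed_arc v)
    (fun x hx => by rcases h x with h | h | h
                    exacts [Or.inl h, Or.inr h, absurd h hx]) (by simp [hd]) with h' | h'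
  exacts [⟨u, key u h'⟩, ⟨v, key v h'⟩]

/-- If three arcs cover the circle, then there are three pairwise intersecting such arcs. -/
lemma exists_pairwise_cover (A : PreArcModel V) {u v w : V}
    (h : ∀ x, x ∈ A.arc u ∨ x ∈ A.arc v ∨ x ∈ A.arc w) :
    ∃ u v w, (∀ x, x ∈ A.arc u ∨ x ∈ A.arc v ∨ x ∈ A.arc w) ∧
      ∀ a ∈ ({u, v, w} : Set V), ∀ b ∈ ({u, v, w} : Set V), (A.arc a ∩ A.arc b).Nonempty := by
  have pair : ∀ y z, A.arc y ∪ A.arc z = Set.univ →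
      ∃ u v w, (∀ x, x ∈ A.arc u ∨ x ∈ A.arc v ∨ x ∈ A.arc w) ∧
      ∀ a ∈ ({u, v, w} : Set V), ∀ b ∈ ({u, v, w} : Set V), (A.arc a ∩ A.arc b).Nonempty := by
    intro y z hyz
    have h1 := A.inter_nonempty_of_union hyz
    have h2 := h1
    rw [Set.inter_comm] at h2
    refine ⟨y, z, z, fun x => ?_, ?_⟩
    · have : x ∈ A.arc y ∪ A.arc z := hyz.ge trivial
      exact this.elim Or.inl fun h => Or.inr (Or.inl h)
    · rintro a (rfl | rfl | rfl) b (rfl | rfl | rfl) <;>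
        first | assumption | (rw [Set.inter_self]; exact A.arc_nonempty _)
  by_cases huv : (A.arc u ∩ A.arc v).Nonempty
  · by_cases huw : (A.arc u ∩ A.arc w).Nonempty
    · by_cases hvw : (A.arc v ∩ A.arc w).Nonempty
      · refine ⟨u, v, w, h, ?_⟩
        rintro a (rfl | rfl | rfl) b (rfl | rfl | rfl) <;>
          first
            | assumption
            | (rw [Set.inter_comm]; assumption)
            | (rw [Set.inter_self]; exact A.arc_nonempty _)
      · obtain ⟨y, hy⟩ := A.union_of_disjoint (w := u) (fun x => by have := h x; tauto) hvw
        exact pair _ _ hy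
    · obtain ⟨y, hy⟩ := A.union_of_disjoint (w := v) (fun x => by have := h x; tauto) huw
      exact pair _ _ hy
  · obtain ⟨y, hy⟩ := A.union_of_disjoint h huv
    exact pair _ _ hy

/-- Among three arcs through a common point, some two have the same union as all three. -/
lemma exists_two_of_common_point (A : PreArcModel V) {u v w : V} {p : AddCircle A.L}
    (hp : ∀ a ∈ ({u, v, w} : Set V), p ∈ A.arc a) :
    ∃ y ∈ ({u, v, w} : Set V), ∃ z ∈ ({u, v, w} : Set V), ∀ a ∈ ({u, v, w} : Set V),
      A.arc a ⊆ A.arc y ∪ A.arc z := by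
  obtain ⟨c, rfl⟩ : ∃ c : ℝ, (c : AddCircle A.L) = p := ⟨_, A.coe_pos 0 p⟩
  have form : ∀ a, (c : AddCircle A.L) ∈ A.arc a → ∃ s t : ℝ,
      ∀ x, x ∈ A.arc a ↔ A.pos c x ≤ t ∨ s ≤ A.pos c x := by
    intro a ha
    obtain ⟨s, t, h | h⟩ := A.exists_arc_form c a
    · rw [h, A.pos_coe_self] at ha
      refine ⟨c + A.L, t, fun x => ?_⟩
      have h1 := A.le_pos c x
      have h2 := A.pos_lt c x
      rw [h]
      exact ⟨fun h => Or.inl h.2, fun h => h.elim (fun h => ⟨by linarith, h⟩)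
        fun h => by linarith⟩
    · exact ⟨s, t, h⟩
  choose! s t hst using form
  obtain ⟨y, hy, hyt⟩ := Set.exists_max_image ({u, v, w} : Set V) t (by simp) ⟨u, by simp⟩
  obtain ⟨z, hz, hzs⟩ := Set.exists_min_image ({u, v, w} : Set V) s (by simp) ⟨u, by simp⟩
  refine ⟨y, hy, z, hz, fun a ha x hx => ?_⟩
  rw [Set.mem_union, hst y (hp y hy), hst z (hp z hz)]
  rw [hst a (hp a ha)] at hx
  have h1 := hyt a ha
  have h2 := hzs a ha
  exact hx.elim (fun h => Or.inl (Or.inl (h.trans h1))) fun h => Or.inr (Or.inr (h2.trans h))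

/-- The points `q i` lie on exactly the arcs of `f i` and `f (i + 1)` among those of the
cycle `f`. -/
def IsCyclePoints (A : PreArcModel V) {n : ℕ} (f : ZMod n → V) (q : ZMod n → AddCircle A.L) :
    Prop :=
  ∀ i j, q i ∈ A.arc (f j) ↔ j = i ∨ j = i + 1

lemma natCast_ne_zero_of_lt {n k : ℕ} (h0 : 0 < k) (hk : k < n) : (k : ZMod n) ≠ 0 := by
  rw [Ne, ZMod.natCast_eq_zero_iff]
  exact fun h => absurd (Nat.le_of_dvd h0 h) (by omega)

lemma IsModelOf.isCyclePoints {A : PreArcModel V} {G : SimpleGraph V} (hA : A.IsModelOf G)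
    {n : ℕ} {f : ZMod n → V} (hf : G.IsHoleOn n f) {q : ZMod n → AddCircle A.L}
    (hq : ∀ i, q i ∈ A.arc (f i) ∧ q i ∈ A.arc (f (i + 1))) : A.IsCyclePoints f q := by
  obtain ⟨hn, hinj, hadj⟩ := hf
  have h3 : (3 : ZMod n) ≠ 0 := by exact_mod_cast natCast_ne_zero_of_lt (k := 3) (by omega) hn
  intro i j
  constructor
  · intro hj
    by_contra! hne
    have h1 := (hadj j i).1 ((hA.2 _ _ (hinj.ne hne.1)).2 ⟨q i, hj, (hq i).1⟩)
    have h2 := (hadj j (i + 1)).1 ((hA.2 _ _ (hinj.ne hne.2)).2 ⟨q i, hj, (hq i).2⟩)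
    grind
  · rintro (rfl | rfl)
    exacts [(hq _).1, (hq _).2]

namespace IsCyclePoints

variable {A : PreArcModel V} {n : ℕ} {f : ZMod n → V} {q : ZMod n → AddCircle A.L}

/-- Seen from any base point, some arc of a hole contains everything outside the range of
the points. -/
lemma exists_outer (hq : A.IsCyclePoints f q) (hn : 4 ≤ n) (c : ℝ) : ∃ i, ∀ z,
    ((∀ j, A.pos c z ≤ A.pos c (q j)) ∨ (∀ j, A.pos c (q j) ≤ A.pos c z)) →
      z ∈ A.arc (f i) := by
  have : NeZero n := ⟨by omega⟩
  have h1 : (1 : ZMod n) ≠ 0 := by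
    exact_mod_cast natCast_ne_zero_of_lt (n := n) (k := 1) (by omega) (by omega)
  have h2 : (2 : ZMod n) ≠ 0 := by
    exact_mod_cast natCast_ne_zero_of_lt (n := n) (k := 2) (by omega) (by omega)
  obtain ⟨m, hm⟩ := Finite.exists_min fun i => A.pos c (q i)
  have key : ∀ i a b, q m ∈ A.arc (f i) → q a ∈ A.arc (f i) → q b ∉ A.arc (f i) →
      A.pos c (q b) ≤ A.pos c (q a) → ∃ i, ∀ z,
    ((∀ j, A.pos c z ≤ A.pos c (q j)) ∨ (∀ j, A.pos c (q j) ≤ A.pos c z)) →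
      z ∈ A.arc (f i) := by
    intro i a b hmi ha hb hab
    have hmb := hm b
    refine ⟨i, fun z hz => ?_⟩
    obtain ⟨s, t, h | h⟩ := A.exists_arc_form c (f i)
    · simp only [h] at *
      exact absurd ⟨hmi.1.trans hmb, hab.trans ha.2⟩ hb
    · simp only [h] at *
      rcases hz with hz | hz
      · left
        have := hz m
        grind
      · right
        have := hz a
        grind
  rcases le_total (A.pos c (q (m - 1))) (A.pos c (q (m + 1))) with hle | hle
  · refine key (m + 1) (m + 1) (m - 1) ((hq _ _).2 (Or.inr rfl)) ((hq _ _).2 (Or.inl rfl)) ?_ hle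
    rw [hq]
    rintro (h | h)
    exacts [h2 (by linear_combination h), h1 (by linear_combination h)]
  · refine key m (m - 1) (m + 1) ((hq _ _).2 (Or.inl rfl)) ((hq _ _).2 (Or.inr (by ring))) ?_ hle
    rw [hq]
    rintro (h | h)
    exacts [h1 (by linear_combination -h), h2 (by linear_combination -h)]

/-- In a proper model, no arc contains a full set of points of a hole. -/
lemma not_forall_mem (hq : A.IsCyclePoints f q) (hn : 4 ≤ n) (hA : A.Proper) (u : V) :
    ¬ ∀ i, q i ∈ A.arc u := by
  intro hu
  have : NeZero n := ⟨by omega⟩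
  have h1 : (1 : ZMod n) ≠ 0 := by
    exact_mod_cast natCast_ne_zero_of_lt (n := n) (k := 1) (by omega) (by omega)
  have h2 : (2 : ZMod n) ≠ 0 := by
    exact_mod_cast natCast_ne_zero_of_lt (n := n) (k := 2) (by omega) (by omega)
  have h3 : (3 : ZMod n) ≠ 0 := by
    exact_mod_cast natCast_ne_zero_of_lt (n := n) (k := 3) (by omega) (by omega)
  obtain ⟨i, hi⟩ := hq.exists_outer hn (A.src u)
  obtain ⟨m, hm⟩ := Finite.exists_min fun i => A.pos (A.src u) (q i)
  obtain ⟨M, hM⟩ := Finite.exists_max fun i => A.pos (A.src u) (q i)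
  have hmi := hi (q m) (Or.inl hm)
  have hMi := hi (q M) (Or.inr hM)
  rw [hq] at hmi hMi
  have hm' : q m ∉ A.arc (f (i + 2)) := by rw [hq]; grind
  have hM' : q M ∉ A.arc (f (i + 2)) := by rw [hq]; grind
  have hmem : q (i + 2) ∈ A.arc (f (i + 2)) := by rw [hq]; simp
  refine hA (f (i + 2)) u ⟨fun x hx => ?_, fun h => hm' (h (hu m))⟩
  have hMu := hu M
  have hmx := hm (i + 2)
  have hMx := hM (i + 2)
  rw [A.mem_arc_iff_pos_src] at hMu ⊢
  obtain ⟨s, t, h | h⟩ := A.exists_arc_form (A.src u) (f (i + 2)) <;> simp only [h] at * <;> grind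

end IsCyclePoints

section ProperHelly

variable {B : PreArcModel V} {G : SimpleGraph V} {n : ℕ} {f : ZMod n → V}

lemma IsModelOf.inter_hole_nonempty (hB : B.IsModelOf G) (hf : G.IsHoleOn n f) (i : ZMod n) :
    (B.arc (f i) ∩ B.arc (f (i + 1))).Nonempty := by
  have h1 : (1 : ZMod n) ≠ 0 := by
    exact_mod_cast natCast_ne_zero_of_lt (n := n) (k := 1) (by omega) (by have := hf.1; omega)
  exact (hB.2 _ _ (hf.2.1.ne (by simpa using h1))).1 ((hf.2.2 _ _).2 (Or.inr rfl))

/-- An arc of a Helly model meeting both ends of an edge of a hole meets their intersection. -/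
lemma Helly.exists_mem_of_meets (hH : B.Helly) (hB : B.IsModelOf G) (hf : G.IsHoleOn n f)
    {x : V} {i : ZMod n} (h1 : (B.arc x ∩ B.arc (f i)).Nonempty)
    (h2 : (B.arc x ∩ B.arc (f (i + 1))).Nonempty) :
    ∃ q ∈ B.arc x, q ∈ B.arc (f i) ∧ q ∈ B.arc (f (i + 1)) := by
  have h3 := hB.inter_hole_nonempty hf i
  obtain ⟨q, hq⟩ := hH {x, f i, f (i + 1)} (by
    rintro a (rfl | rfl | rfl) b (rfl | rfl | rfl) <;>
      first
        | assumption
        | (rw [Set.inter_comm]; assumption)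
        | (rw [Set.inter_self]; exact B.arc_nonempty _))
  simp only [Set.mem_iInter] at hq
  exact ⟨q, hq _ (by simp), hq _ (by simp), hq _ (by simp)⟩

/-- In a proper Helly model of a graph with a hole, two arcs do not cover the circle. -/
lemma not_cover_two (hB : B.IsModelOf G) (hP : B.Proper) (hH : B.Helly) (hf : G.IsHoleOn n f)
    (u v : V) : B.arc u ∪ B.arc v ≠ Set.univ := by
  intro h
  obtain ⟨p, hpu, hpv⟩ := B.inter_nonempty_of_union h
  have meets : ∀ i, (B.arc u ∩ B.arc (f i)).Nonempty := by
    intro i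
    by_contra hne
    refine hP (f i) v ⟨fun x hx => ?_, fun hs => hne ⟨p, hpu, hs hpv⟩⟩
    have : x ∈ B.arc u ∪ B.arc v := h.ge trivial
    exact this.resolve_left fun hxu => hne ⟨x, hxu, hx⟩
  choose q hqu hq using fun i => hH.exists_mem_of_meets hB hf (meets i) (meets (i + 1))
  exact (hB.isCyclePoints hf hq).not_forall_mem hf.1 hP u hqu

/-- In a proper Helly model of a graph with a hole, three arcs do not cover the circle. -/
lemma not_cover_three (hB : B.IsModelOf G) (hP : B.Proper) (hH : B.Helly)
    (hf : G.IsHoleOn n f) (u v w : V) :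
    ¬ ∀ x, x ∈ B.arc u ∨ x ∈ B.arc v ∨ x ∈ B.arc w := by
  intro h
  obtain ⟨u, v, w, h, hpw⟩ := B.exists_pairwise_cover h
  obtain ⟨p, hp⟩ := hH _ hpw
  simp only [Set.mem_iInter] at hp
  obtain ⟨y, -, z, -, hyz⟩ := B.exists_two_of_common_point hp
  refine not_cover_two hB hP hH hf y z (Set.eq_univ_of_forall fun x => ?_)
  rcases h x with h | h | h <;> exact hyz _ (by simp) h

/-- In a proper Helly model, points of a hole are not contained in two intersecting arcs. -/
lemma not_cyclePoints_subset_union (hB : B.IsModelOf G) (hP : B.Proper) (hH : B.Helly)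
    (hf : G.IsHoleOn n f) {q : ZMod n → AddCircle B.L} (hq : B.IsCyclePoints f q) {y z : V}
    (hyz : (B.arc y ∩ B.arc z).Nonempty) : ¬ ∀ i, q i ∈ B.arc y ∪ B.arc z := by
  intro hmem
  obtain ⟨p, hpy, hpz⟩ := hyz
  obtain ⟨o, ho⟩ := (Set.ne_univ_iff_exists_notMem _).1 (not_cover_two hB hP hH hf y z)
  rw [Set.mem_union, not_or] at ho
  obtain ⟨c, rfl⟩ : ∃ c : ℝ, (c : AddCircle B.L) = o := ⟨_, B.coe_pos 0 o⟩
  obtain ⟨s, t, hy⟩ := B.exists_arc_interval ho.1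
  obtain ⟨s', t', hz⟩ := B.exists_arc_interval ho.2
  obtain ⟨i, hi⟩ := hq.exists_outer hf.1 c
  refine not_cover_three hB hP hH hf y z (f i) fun x => ?_
  by_contra! hx
  have hxi := mt (hi x) hx.2.2
  push Not at hxi
  obtain ⟨⟨j, hj⟩, k, hk⟩ := hxi
  have hmj := hmem j
  have hmk := hmem k
  simp only [Set.mem_union, hy, hz] at *
  grind

end ProperHelly

end PreArcModel

/-- In any arc model of a non-chordal proper Helly circular-arc graph,
at least four arcs are needed to cover the whole circle. -/
theorem stmt4 {V : Type*} [Fintype V] (G : SimpleGraph V) (hphca : G.IsPHCA)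
    (hnc : ¬ G.Chordal) (A : PreArcModel V) (hA : A.IsModelOf G)
    (S : Finset V) (hcov : (⋃ v ∈ S, A.arc v) = Set.univ) :
    4 ≤ S.card := by
  classical
  obtain ⟨B, hB, hP, hH⟩ := hphca
  obtain ⟨n, f, hf⟩ := not_not.1 hnc
  by_contra! hcard
  have hmem : ∀ x, ∃ a ∈ S, x ∈ A.arc a := by
    intro x
    have : x ∈ ⋃ v ∈ S, A.arc v := hcov.ge trivial
    simpa using this
  obtain ⟨u, v, w, hS⟩ : ∃ u v w, S ⊆ {u, v, w} := by
    obtain ⟨u, hu, -⟩ := hmem 0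
    have h1 : (S.erase u).card ≤ 2 := by
      rw [Finset.card_erase_of_mem hu]; omega
    rcases (S.erase u).eq_empty_or_nonempty with he | ⟨v, hv⟩
    · exact ⟨u, u, u, fun x hx => by
        have := Finset.eq_empty_iff_forall_notMem.1 he x
        grind⟩
    have h2 : ((S.erase u).erase v).card ≤ 1 := by
      rw [Finset.card_erase_of_mem hv]; omega
    rcases ((S.erase u).erase v).eq_empty_or_nonempty with he | ⟨w, hw⟩
    · exact ⟨u, v, v, fun x hx => by
        have := Finset.eq_empty_iff_forall_notMem.1 he x
        grind⟩
    · refine ⟨u, v, w, fun x hx => ?_⟩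
      have := fun hx' => Finset.card_le_one.1 h2 x hx' w hw
      grind
  obtain ⟨u, v, w, hcover, hpw⟩ := A.exists_pairwise_cover (u := u) (v := v) (w := w) (by
    intro x
    obtain ⟨a, ha, hx⟩ := hmem x
    have := hS ha
    simp only [Finset.mem_insert, Finset.mem_singleton] at this
    rcases this with rfl | rfl | rfl <;> simp [hx])
  have transfer : ∀ a b, (A.arc a ∩ A.arc b).Nonempty → (B.arc a ∩ B.arc b).Nonempty := by
    intro a b hab
    by_cases h : a = b
    · subst h
      rw [Set.inter_self]
      exact B.arc_nonempty a
    · exact (hB.2 a b h).1 ((hA.2 a b h).2 hab)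
  obtain ⟨p, hp⟩ := hH _ fun a ha b hb => transfer a b (hpw a ha b hb)
  simp only [Set.mem_iInter] at hp
  obtain ⟨y, hy, z, hz, hyz⟩ := B.exists_two_of_common_point hp
  have edge : ∀ i, ∃ q, (∃ a ∈ ({u, v, w} : Set V), q ∈ B.arc a) ∧
      q ∈ B.arc (f i) ∧ q ∈ B.arc (f (i + 1)) := by
    intro i
    obtain ⟨r, hr1, hr2⟩ := hA.inter_hole_nonempty hf i
    obtain ⟨a, ha, hra⟩ : ∃ a ∈ ({u, v, w} : Set V), r ∈ A.arc a := by
      rcases hcover r with h | h | h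
      exacts [⟨u, by simp, h⟩, ⟨v, by simp, h⟩, ⟨w, by simp, h⟩]
    obtain ⟨q, hqa, hq⟩ := hH.exists_mem_of_meets hB hf (transfer _ _ ⟨r, hra, hr1⟩)
      (transfer _ _ ⟨r, hra, hr2⟩)
    exact ⟨q, ⟨a, ha, hqa⟩, hq⟩
  choose q hqa hq using edge
  refine PreArcModel.not_cyclePoints_subset_union hB hP hH hf (hB.isCyclePoints hf hq)
    ⟨p, hp y hy, hp z hz⟩ fun i => ?_
  obtain ⟨a, ha, hqa⟩ := hqa i
  exact hyz a ha hqa
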